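/- Neyman–Pearson lemma (underlying Proposition 5.1): Let (Ω, 𝒜, μ) be a measure space and let p, q : Ω → ℝ≥0 be measurable, μ-integrable density functions. Fix k > 0 and let φ* be the indicator function of the set {ω : q(ω) ≥ k · p(ω)}. Then for every measurable test φ : Ω → [0,1] satisfying ∫ φ · p dμ ≤ ∫ φ* · p dμ, one has ∫ φ · q dμ ≤ ∫ φ* · q dμ; i.e., among all tests of no larger size under the density p, the likelihood-ratio threshold test φ* maximizes power under the density q. -/

import Mathlib

set_option autoImplicit false

open MeasureTheory

/-- The product of a `[0,1]`-valued measurable function and an integrable function is integrable. -/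
theorem integrable_mul_of_mem_Icc {Ω : Type*} [MeasurableSpace Ω] {μ : Measure Ω}
    {f g : Ω → ℝ} (hf : Measurable f) (hf01 : ∀ ω, f ω ∈ Set.Icc (0 : ℝ) 1)
    (hg : Integrable g μ) : Integrable (fun ω => f ω * g ω) μ := by
  refine hg.mono (hf.aestronglyMeasurable.mul hg.aestronglyMeasurable) (.of_forall fun ω => ?_)
  rw [norm_mul, Real.norm_of_nonneg (hf01 ω).1]
  exact mul_le_of_le_one_left (norm_nonneg _) (hf01 ω).2

/-- **Neyman–Pearson lemma.** Among all (randomized) tests `φ : Ω → [0,1]` whose size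
`∫ φ·p dμ` under the density `p` is no larger than that of the likelihood-ratio
threshold test `φ* = 1{q ≥ k·p}`, the test `φ*` maximizes the power `∫ φ·q dμ`
under the density `q`. -/
theorem neyman_pearson
    {Ω : Type*} [MeasurableSpace Ω] (μ : Measure Ω)
    (p q : Ω → ℝ) (hp_meas : Measurable p) (hq_meas : Measurable q)
    (hp_nonneg : ∀ ω, 0 ≤ p ω) (hq_nonneg : ∀ ω, 0 ≤ q ω)
    (hp_int : Integrable p μ) (hq_int : Integrable q μ)
    (k : ℝ) (hk : 0 < k)
    (φstar : Ω → ℝ)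
    (hφstar : φstar = Set.indicator {ω | k * p ω ≤ q ω} (fun _ => (1 : ℝ)))
    (φ : Ω → ℝ) (hφ_meas : Measurable φ)
    (hφ01 : ∀ ω, φ ω ∈ Set.Icc (0 : ℝ) 1)
    (hsize : ∫ ω, φ ω * p ω ∂μ ≤ ∫ ω, φstar ω * p ω ∂μ) :
    ∫ ω, φ ω * q ω ∂μ ≤ ∫ ω, φstar ω * q ω ∂μ := by
  have hstar_meas : Measurable φstar := by
    rw [hφstar]
    exact measurable_const.indicator (measurableSet_le (hp_meas.const_mul k) hq_meas)
  have hstar01 : ∀ ω, φstar ω ∈ Set.Icc (0 : ℝ) 1 := fun ω => by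
    rw [hφstar]
    by_cases h : k * p ω ≤ q ω <;> simp [h]
  have hφp := integrable_mul_of_mem_Icc hφ_meas hφ01 hp_int
  have hφq := integrable_mul_of_mem_Icc hφ_meas hφ01 hq_int
  have hsp := integrable_mul_of_mem_Icc hstar_meas hstar01 hp_int
  have hsq := integrable_mul_of_mem_Icc hstar_meas hstar01 hq_int
  have hpointwise : ∀ ω,
      φ ω * q ω - k * (φ ω * p ω) ≤ φstar ω * q ω - k * (φstar ω * p ω) := fun ω => by
    obtain ⟨h0, h1⟩ := hφ01 ω
    rw [hφstar]
    by_cases h : k * p ω ≤ q ω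
    · simp only [Set.indicator, Set.mem_ofPred_eq, h, if_true]
      nlinarith [mul_nonneg (sub_nonneg.2 h1) (sub_nonneg.2 h)]
    · simp only [Set.indicator, Set.mem_ofPred_eq, h, if_false]
      nlinarith [mul_nonneg h0 (sub_nonneg.2 (not_le.1 h).le)]
  have hint := integral_mono (hφq.sub (hφp.const_mul k)) (hsq.sub (hsp.const_mul k)) hpointwise
  simp only [Pi.sub_apply] at hint
  rw [integral_sub hφq (hφp.const_mul k), integral_sub hsq (hsp.const_mul k),
    integral_const_mul, integral_const_mul] at hint
  linarith [mul_le_mul_of_nonneg_left hsize hk.le]
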